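/- arXiv:2207.10372 — 2 statements merged into one kernel-verified Lean document; each statement's English description precedes it below -/
import Mathlib

section
/- Suppose HM (the product of H and M) is injective and 0 < τ < 1/(‖H‖²‖M‖²). Then there is no pair (λ, y) with λ ∈ ℂ, |λ| ≥ 1, y ∈ ℂ^{n_σ}, y ≠ 0, satisfying λ(λ − 1)‖y‖² + τ‖HMy‖² = 0. -/
open Matrix

/-- Operator norm induced by the Euclidean norms. -/
noncomputable def opNorm {𝕜 : Type*} [RCLike 𝕜] {m n : ℕ} (A : Matrix (Fin m) (Fin n) 𝕜) : ℝ :=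
  ‖LinearMap.toContinuousLinearMap (Matrix.toEuclideanLin A)‖

theorem dotProduct_mulVec_self_le {m n : ℕ} (A : Matrix (Fin m) (Fin n) ℝ) (x : Fin n → ℝ) :
    (A *ᵥ x) ⬝ᵥ (A *ᵥ x) ≤ opNorm A ^ 2 * (x ⬝ᵥ x) := by
  have norm_sq (k : ℕ) (z : Fin k → ℝ) : z ⬝ᵥ z = ‖WithLp.toLp 2 z‖ ^ 2 := by
    simp [EuclideanSpace.norm_sq_eq, dotProduct, ← sq]
  have h := (LinearMap.toContinuousLinearMap (Matrix.toEuclideanLin A)).le_opNorm (WithLp.toLp 2 x)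
  rw [norm_sq, norm_sq, ← mul_pow]
  exact pow_le_pow_left₀ (norm_nonneg _) h 2

theorem star_dotProduct_self_eq_re_add_im {n : ℕ} (y : Fin n → ℂ) :
    star y ⬝ᵥ y = (((fun i => (y i).re) ⬝ᵥ (fun i => (y i).re) +
      (fun i => (y i).im) ⬝ᵥ (fun i => (y i).im) : ℝ) : ℂ) := by
  simp only [dotProduct, ← Finset.sum_add_distrib, Complex.ofReal_sum]
  refine Finset.sum_congr rfl fun i _ => ?_
  rw [Pi.star_apply, ← Complex.normSq_apply, Complex.normSq_eq_conj_mul_self]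
  rfl

theorem star_map_ofReal_mulVec_dotProduct_self {m n : ℕ} (A : Matrix (Fin m) (Fin n) ℝ)
    (y : Fin n → ℂ) :
    star ((A.map Complex.ofReal) *ᵥ y) ⬝ᵥ ((A.map Complex.ofReal) *ᵥ y) =
      (((A *ᵥ fun i => (y i).re) ⬝ᵥ (A *ᵥ fun i => (y i).re) +
        (A *ᵥ fun i => (y i).im) ⬝ᵥ (A *ᵥ fun i => (y i).im) : ℝ) : ℂ) := by
  rw [star_dotProduct_self_eq_re_add_im]
  have hre : (fun i => (((A.map Complex.ofReal) *ᵥ y) i).re) = A *ᵥ fun i => (y i).re := by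
    ext i
    simp [mulVec, dotProduct]
  have him : (fun i => (((A.map Complex.ofReal) *ᵥ y) i).im) = A *ᵥ fun i => (y i).im := by
    ext i
    simp [mulVec, dotProduct]
  rw [hre, him]

/-- If `0 < q < p`, both roots of `p * z * (z - 1) + q` lie in the open unit disc. -/
theorem norm_lt_one_of_mul_sub_one_mul_add_eq_zero {p q : ℝ} (hq : 0 < q) (hqp : q < p) {z : ℂ}
    (hz : z * (z - 1) * (p : ℂ) + (q : ℂ) = 0) : ‖z‖ < 1 := by
  have hp : 0 < p := hq.trans hqp
  have hre := congrArg Complex.re hz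
  have him := congrArg Complex.im hz
  simp at hre him
  rw [← sq_lt_one_iff₀ (norm_nonneg z), ← Complex.normSq_eq_norm_sq, Complex.normSq_apply]
  rcases him with him | him
  swap
  · exact absurd him hp.ne'
  have hprod : z.im * (2 * z.re - 1) = 0 := by linarith
  rcases mul_eq_zero.mp hprod with h0 | h0
  · rw [h0] at hre ⊢
    have hneg : z.re * (z.re - 1) < 0 := by
      by_contra! h
      nlinarith [mul_nonneg h hp.le]
    nlinarith [sq_nonneg z.re]
  · have hx : z.re = 1 / 2 := by linarith
    rw [hx] at hre ⊢
    by_contra! h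
    nlinarith [mul_nonneg (sub_nonneg.mpr h) hp.le]

/-- the eigenvalue equation of the one-step one-shot method with
`B = 0` has no solution `|λ| ≥ 1` when `τ < 1/(‖H‖²‖M‖²)`. -/
theorem one_step_one_shot_B_eq_zero
    {nu nσ nf : ℕ}
    (M : Matrix (Fin nu) (Fin nσ) ℝ) (H : Matrix (Fin nf) (Fin nu) ℝ)
    (hInj : Function.Injective fun x : Fin nσ → ℝ => (H * M) *ᵥ x)
    (τ : ℝ) (hτ : 0 < τ)
    (hτlt : τ < 1 / (opNorm H ^ 2 * opNorm M ^ 2)) :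
    ¬ ∃ (lam : ℂ) (y : Fin nσ → ℂ), 1 ≤ ‖lam‖ ∧ y ≠ 0 ∧
      lam * (lam - 1) * (star y ⬝ᵥ y) +
        (τ : ℂ) * (star (((H * M).map Complex.ofReal) *ᵥ y) ⬝ᵥ
          (((H * M).map Complex.ofReal) *ᵥ y)) = 0 := by
  rintro ⟨lam, y, hlam, hy, heq⟩
  rw [star_map_ofReal_mulVec_dotProduct_self, star_dotProduct_self_eq_re_add_im,
    ← Complex.ofReal_mul] at heq
  have self_nonneg {k : ℕ} (x : Fin k → ℝ) : 0 ≤ x ⬝ᵥ x :=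
    Finset.sum_nonneg fun i _ => mul_self_nonneg (x i)
  have mulVec_self_pos (x : Fin nσ → ℝ) (hx : x ≠ 0) :
      0 < ((H * M) *ᵥ x) ⬝ᵥ ((H * M) *ᵥ x) := by
    refine (self_nonneg _).lt_of_ne' fun h => hx (hInj ?_)
    simpa using dotProduct_self_eq_zero.mp h
  have mulVec_self_le (x : Fin nσ → ℝ) :
      ((H * M) *ᵥ x) ⬝ᵥ ((H * M) *ᵥ x) ≤ opNorm H ^ 2 * opNorm M ^ 2 * (x ⬝ᵥ x) := by
    rw [← mulVec_mulVec, mul_assoc]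
    exact (dotProduct_mulVec_self_le H _).trans
      (mul_le_mul_of_nonneg_left (dotProduct_mulVec_self_le M x) (sq_nonneg _))
  have hK : 0 < opNorm H ^ 2 * opNorm M ^ 2 := one_div_pos.mp (hτ.trans hτlt)
  have hτK : τ * (opNorm H ^ 2 * opNorm M ^ 2) < 1 := (lt_div_iff₀ hK).mp hτlt
  set a : Fin nσ → ℝ := fun i => (y i).re
  set b : Fin nσ → ℝ := fun i => (y i).im
  have hab : a ≠ 0 ∨ b ≠ 0 := by
    by_contra! h
    exact hy (funext fun i => Complex.ext (congrFun h.1 i) (congrFun h.2 i))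
  have hpos : 0 < ((H * M) *ᵥ a) ⬝ᵥ ((H * M) *ᵥ a) + ((H * M) *ᵥ b) ⬝ᵥ ((H * M) *ᵥ b) := by
    rcases hab with h | h
    · exact add_pos_of_pos_of_nonneg (mulVec_self_pos a h) (self_nonneg _)
    · exact add_pos_of_nonneg_of_pos (self_nonneg _) (mulVec_self_pos b h)
  have hle : ((H * M) *ᵥ a) ⬝ᵥ ((H * M) *ᵥ a) + ((H * M) *ᵥ b) ⬝ᵥ ((H * M) *ᵥ b) ≤
      opNorm H ^ 2 * opNorm M ^ 2 * (a ⬝ᵥ a + b ⬝ᵥ b) := by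
    rw [mul_add]
    exact add_le_add (mulVec_self_le a) (mulVec_self_le b)
  have hy_pos : 0 < a ⬝ᵥ a + b ⬝ᵥ b := pos_of_mul_pos_right (hpos.trans_le hle) hK.le
  refine hlam.not_gt (norm_lt_one_of_mul_sub_one_mul_add_eq_zero (mul_pos hτ hpos) ?_ heq)
  calc _ ≤ τ * (opNorm H ^ 2 * opNorm M ^ 2 * (a ⬝ᵥ a + b ⬝ᵥ b)) :=
        mul_le_mul_of_nonneg_left hle hτ.le
    _ = τ * (opNorm H ^ 2 * opNorm M ^ 2) * (a ⬝ᵥ a + b ⬝ᵥ b) := by ring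
    _ < a ⬝ᵥ a + b ⬝ᵥ b := mul_lt_of_lt_one_left hy_pos hτK
end

section
/- For every τ > 0, the equation (λ − 1)‖y‖² + τλ·⟨Mᵀ(λI − Bᵀ)⁻¹HᵀH(λI − B)⁻¹M y, y⟩ = 0 has no solution with λ ∈ ℝ, λ ≠ 1, |λ| ≥ 1 and y ∈ ℂ^{n_σ}, y ≠ 0. -/
open Matrix

/-- The complexification of a real matrix has the same transpose and conjugate transpose. -/
lemma conjTranspose_map_ofReal {m n : Type*} (A : Matrix m n ℝ) :
    (A.map Complex.ofReal)ᴴ = (A.map Complex.ofReal)ᵀ := by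
  ext i j
  simp [Matrix.conjTranspose_apply]

open scoped ComplexOrder in
lemma re_star_dotProduct_self_pos {n : Type*} [Fintype n] {y : n → ℂ} (hy : y ≠ 0) :
    0 < (star y ⬝ᵥ y).re :=
  (Complex.pos_iff.mp (dotProduct_star_self_pos_iff.mpr hy)).1

open scoped ComplexOrder in
lemma re_star_dotProduct_conjTranspose_mul_self_mulVec_nonneg {m n : Type*} [Fintype m]
    [Fintype n] (G : Matrix m n ℂ) (y : n → ℂ) :
    0 ≤ (star y ⬝ᵥ ((Gᴴ * G) *ᵥ y)).re :=
  (Complex.nonneg_iff.mp ((posSemidef_conjTranspose_mul_self G).dotProduct_mulVec_nonneg y)).1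


/-- the eigenvalue equation of the one-step one-shot method has no real
solution `λ ≠ 1`, `|λ| ≥ 1`, for every `τ > 0`. -/
theorem one_step_one_shot_real_eigenvalues
    {nu nσ nf : ℕ}
    (B : Matrix (Fin nu) (Fin nu) ℝ) (M : Matrix (Fin nu) (Fin nσ) ℝ)
    (H : Matrix (Fin nf) (Fin nu) ℝ)
    (hρ : ∀ μ ∈ spectrum ℂ (B.map Complex.ofReal), ‖μ‖ < 1)
    (τ : ℝ) (hτ : 0 < τ) :
    ∀ lam : ℝ, lam ≠ 1 → 1 ≤ |lam| → ∀ y : Fin nσ → ℂ, y ≠ 0 →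
      ((lam : ℂ) - 1) * (star y ⬝ᵥ y) +
        (τ : ℂ) * (lam : ℂ) * (star y ⬝ᵥ
          (((M.map Complex.ofReal)ᵀ *
              ((lam : ℂ) • (1 : Matrix (Fin nu) (Fin nu) ℂ) - (B.map Complex.ofReal)ᵀ)⁻¹ *
              ((H.map Complex.ofReal)ᵀ * (H.map Complex.ofReal)) *
              ((lam : ℂ) • (1 : Matrix (Fin nu) (Fin nu) ℂ) - B.map Complex.ofReal)⁻¹ *
              M.map Complex.ofReal) *ᵥ y)) ≠ 0 := by
  intro lam h1 habs y hy heq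
  set G : Matrix (Fin nf) (Fin nσ) ℂ := H.map Complex.ofReal *
    ((lam : ℂ) • (1 : Matrix (Fin nu) (Fin nu) ℂ) - B.map Complex.ofReal)⁻¹ *
    M.map Complex.ofReal with hG
  have hGG : (M.map Complex.ofReal)ᵀ *
      ((lam : ℂ) • (1 : Matrix (Fin nu) (Fin nu) ℂ) - (B.map Complex.ofReal)ᵀ)⁻¹ *
      ((H.map Complex.ofReal)ᵀ * (H.map Complex.ofReal)) *
      ((lam : ℂ) • (1 : Matrix (Fin nu) (Fin nu) ℂ) - B.map Complex.ofReal)⁻¹ *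
      M.map Complex.ofReal = Gᴴ * G := by
    simp only [hG, conjTranspose_mul, conjTranspose_nonsing_inv, conjTranspose_sub,
      conjTranspose_smul, conjTranspose_one, conjTranspose_map_ofReal, Complex.star_def,
      Complex.conj_ofReal, Matrix.mul_assoc]
  have ha := re_star_dotProduct_self_pos hy
  have hb := re_star_dotProduct_conjTranspose_mul_self_mulVec_nonneg G y
  rw [hGG] at heq
  generalize star y ⬝ᵥ y = a at ha heq
  generalize star y ⬝ᵥ ((Gᴴ * G) *ᵥ y) = b at hb heq
  have hre := congrArg Complex.re heq
  simp only [Complex.add_re, Complex.mul_re, Complex.mul_im, Complex.sub_re, Complex.sub_im,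
    Complex.ofReal_re, Complex.ofReal_im, Complex.one_re, Complex.one_im, Complex.zero_re,
    sub_zero, mul_zero, zero_mul, add_zero] at hre
  rcases le_abs.mp habs with h | h
  · have hlt : 0 < lam - 1 := sub_pos.mpr (lt_of_le_of_ne h h1.symm)
    have := mul_pos hlt ha
    have : 0 ≤ τ * lam * b.re := by positivity
    linarith
  · have : (lam - 1) * a.re < 0 := mul_neg_of_neg_of_pos (by linarith) ha
    have : 0 ≤ τ * (-lam) * b.re := mul_nonneg (mul_nonneg hτ.le (by linarith)) hb
    linarith
end
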